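/- For every d ≥ 1 and every infinite set X ⊆ ℕ, there exists a vector sequence 𝐡 : X → ℕ^d of dimension d, indexed by X, which is not an asymptotic mix of any vector sequence X → ℕ^(d−1) of dimension d−1. -/

import Mathlib

def BddOnP {I : Type*} (f : I → ℕ) (S : Set I) : Prop := ∃ B, ∀ i ∈ S, f i ≤ B

def AsympEquiv {I : Type*} (f g : I → ℕ) : Prop := ∀ S : Set I, BddOnP f S ↔ BddOnP g S

def MemVS {I : Type*} {d : ℕ} (f : I → ℕ) (F : I → Fin d → ℕ) : Prop := ∀ i, ∃ j, f i = F i j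

def IsMix {I : Type*} {d e : ℕ} (F : I → Fin d → ℕ) (G : I → Fin e → ℕ) : Prop :=
  ∀ f : I → ℕ, MemVS f F → ∃ g : I → ℕ, MemVS g G ∧ AsympEquiv f g

theorem stmt_9 (d : ℕ) (hd : 1 ≤ d) (X : Set ℕ) (hX : X.Infinite) :
    ∃ H : X → Fin d → ℕ, ∀ G : X → Fin (d - 1) → ℕ, ¬ IsMix H G := by
  haveI : Infinite X := hX.to_subtype
  haveI : Nonempty (Fin d) := ⟨⟨0, hd⟩⟩
  obtain ⟨e⟩ : Nonempty (X ≃ (Fin d → ℕ)) := nonempty_equiv_of_countable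
  refine ⟨fun x => e x, fun G hG => ?_⟩
  have h1 : ∀ i : Fin d, ∃ g : X → ℕ, MemVS g G ∧ AsympEquiv (fun x => e x i) g :=
    fun i => hG _ (fun x => ⟨i, rfl⟩)
  choose g hg hga using h1
  choose k hk using hg
  have h2 : ∀ (i j : Fin d) (n : ℕ), ∃ B, ∀ x : X, e x i = n → g i x = g j x → e x j ≤ B := by
    intro i j n
    have hi : BddOnP (fun x => e x i) {x : X | e x i = n ∧ g i x = g j x} :=
      ⟨n, fun x hx => hx.1.le⟩
    obtain ⟨C, hC⟩ := (hga i _).1 hi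
    have hj : BddOnP (g j) {x : X | e x i = n ∧ g i x = g j x} :=
      ⟨C, fun x hx => hx.2 ▸ hC x hx⟩
    obtain ⟨B, hB⟩ := (hga j _).2 hj
    exact ⟨B, fun x hx hx' => hB x ⟨hx, hx'⟩⟩
  choose B hB using h2
  let φ : ℕ → ℕ := fun n => n + 1 + ∑ m ∈ Finset.range (n + 1), ∑ i, ∑ j, B i j m
  have hφ : ∀ i j m n, m ≤ n → B i j m < φ n := by
    intro i j m n hmn
    have a1 : B i j m ≤ ∑ j, B i j m :=
      Finset.single_le_sum (f := fun j => B i j m) (fun _ _ => Nat.zero_le _) (Finset.mem_univ j)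
    have a2 : ∑ j, B i j m ≤ ∑ i, ∑ j, B i j m :=
      Finset.single_le_sum (f := fun i => ∑ j, B i j m) (fun _ _ => Nat.zero_le _)
        (Finset.mem_univ i)
    have a3 : ∑ i, ∑ j, B i j m ≤ ∑ m ∈ Finset.range (n + 1), ∑ i, ∑ j, B i j m :=
      Finset.single_le_sum (f := fun m => ∑ i, ∑ j, B i j m) (fun _ _ => Nat.zero_le _)
        (Finset.mem_range.2 (by omega))
    show _ < n + 1 + _
    omega
  let u : ℕ → ℕ := fun n => φ^[n] 0
  have hu : ∀ n, u (n + 1) = φ (u n) := fun n => Function.iterate_succ_apply' φ n 0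
  have hmono : Monotone u := monotone_nat_of_le_succ (fun n => by
    rw [hu]
    show u n ≤ u n + 1 + _
    omega)
  let x : X := e.symm (fun i => u i)
  have hx : ∀ i, e x i = u i := fun i => by simp [x]
  have key : ∀ i j : Fin d, i < j → g i x = g j x → False := by
    intro i j hij h
    have h3 := hB i j (u i) x (hx i) h
    rw [hx j] at h3
    have hlt : (i : ℕ) < j := hij
    obtain ⟨m, hm⟩ : ∃ m, (j : ℕ) = m + 1 := ⟨j - 1, by omega⟩
    rw [hm, hu] at h3
    exact absurd h3 (not_le.2 (hφ i j _ _ (hmono (by omega))))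
  obtain ⟨i, j, hij, h⟩ := Fintype.exists_ne_map_eq_of_card_lt (fun i : Fin d => k i x)
    (by simp only [Fintype.card_fin]; omega)
  have hgg : g i x = g j x := by
    rw [hk i x, hk j x]
    exact congrArg _ h
  rcases lt_or_gt_of_ne hij with h' | h'
  · exact key i j h' hgg
  · exact key j i h' hgg.symm
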